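/- For every δ > 0 there exists N such that for every perfect square n ≥ N and every subset B' ⊆ B with |B'| ≥ δ|B|, the number of vectors u ∈ A' that are B'-compatible is at most exp(−n^{3/4})·|A'|. -/

import Mathlib

open Finset

/-- `B = {v ∈ F_2^n : |v| = √n}` (for `n = s²`). -/
def sphereB (n s : ℕ) : Finset (Fin n → ZMod 2) :=
  Finset.univ.filter (fun v => hammingNorm v = s)

/-- `A' = {v ∈ F_2^n : |v| ≤ n/2 − 10¹⁵·n^{3/4}}`. -/
noncomputable def setA' (n : ℕ) : Set (Fin n → ZMod 2) :=
  {v | (hammingNorm v : ℝ) ≤ n / 2 - 10 ^ 15 * (n : ℝ) ^ ((3 : ℝ) / 4)}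

/-- `u` is `B'`-compatible: the number of `w ∈ B'` with `|u + w| ≤ |u|` is at least `|B'|/3`. -/
def Compatible (n : ℕ) (B' : Finset (Fin n → ZMod 2)) (u : Fin n → ZMod 2) : Prop :=
  (B'.card : ℝ) / 3 ≤ ((B'.filter (fun w => hammingNorm (u + w) ≤ hammingNorm u)).card : ℝ)

section

open Real

noncomputable def xx (a : ZMod 2) : ℝ := if a = 0 then 0 else 1

noncomputable def ip {n : ℕ} (u : Fin n → ZMod 2) (V : Fin n → ℝ) : ℝ := ∑ i, xx (u i) * V i

lemma xx_sq (a : ZMod 2) : xx a * xx a = xx a := by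
  unfold xx; split_ifs <;> simp

lemma xx_nonneg (a : ZMod 2) : 0 ≤ xx a := by
  unfold xx; split_ifs <;> simp

lemma xx_add (a b : ZMod 2) : xx (a + b) = xx a + xx b - 2 * (xx a * xx b) := by
  have h : ∀ a : ZMod 2, a = 0 ∨ a = 1 := by decide
  have h2 : (1 : ZMod 2) + 1 = 0 := by decide
  rcases h a with rfl | rfl <;> rcases h b with rfl | rfl <;> simp [xx, h2] <;> norm_num

lemma norm_xx {n : ℕ} (u : Fin n → ZMod 2) : (hammingNorm u : ℝ) = ∑ i, xx (u i) := by
  unfold hammingNorm xx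
  rw [Finset.card_filter]
  push_cast
  apply Finset.sum_congr rfl
  intro i _
  by_cases h : u i = 0 <;> simp [h]

lemma norm_add_xx {n : ℕ} (u w : Fin n → ZMod 2) :
    (hammingNorm (u + w) : ℝ) = hammingNorm u + hammingNorm w - 2 * ∑ i, xx (u i) * xx (w i) := by
  rw [norm_xx, norm_xx, norm_xx, Finset.mul_sum, ← Finset.sum_add_distrib,
    ← Finset.sum_sub_distrib]
  apply Finset.sum_congr rfl
  intro i _
  exact xx_add _ _

lemma hoeff (p x : ℝ) (h0 : 0 ≤ p) (h1 : p ≤ 1) :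
    1 - p + p * exp x ≤ exp (p * x + x ^ 2 / 2) := by
  have hj : exp (-(p * x)) ≤ 1 - p + p * exp (-x) := by
    have := convexOn_exp.2 (Set.mem_univ (0:ℝ)) (Set.mem_univ (-x))
      (by linarith : 0 ≤ 1 - p) h0 (by ring)
    simp only [smul_eq_mul, mul_zero, zero_add, exp_zero, mul_one] at this
    rwa [mul_neg] at this
  have hc := Real.cosh_le_exp_half_sq x
  have hc1 := Real.one_le_cosh x
  have hcosh := Real.cosh_eq x
  have hpos : 0 ≤ 1 - p + p * exp x := by
    have := (exp_pos x).le
    have := mul_nonneg h0 this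
    linarith
  have hprod : (1 - p + p * exp x) * exp (-(p * x)) ≤ exp (x ^ 2 / 2) := by
    refine le_trans (mul_le_mul_of_nonneg_left hj hpos) (le_trans ?_ hc)
    have he : exp x * exp (-x) = 1 := by rw [← exp_add]; simp
    have : (1 - p + p * exp x) * (1 - p + p * exp (-x))
        = (1-p)^2 + p^2 * (exp x * exp (-x)) + 2 * p * (1-p) * ((exp x + exp (-x)) / 2) := by ring
    rw [this, he, ← hcosh]
    nlinarith [mul_nonneg h0 (by linarith : 0 ≤ 1 - p), sq_nonneg (1-p), sq_nonneg p]
  rw [exp_neg] at hprod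
  rw [exp_add, mul_comm (exp (p * x))]
  rwa [← div_eq_mul_inv, div_le_iff₀ (exp_pos _)] at hprod

def TT (n m j : ℕ) : ℕ := n.choose j * m ^ j * (n - m) ^ (n - j)

lemma TT_eq (n m j : ℕ) (hj : j < n) :
    (j + 1) * TT n m j = (n.choose j * m ^ j * (n - m) ^ (n - (j+1))) * ((j+1) * (n - m)) ∧
    (j + 1) * TT n m (j+1) = (n.choose j * m ^ j * (n - m) ^ (n - (j+1))) * ((n - j) * m) := by
  unfold TT
  constructor
  · have : n - j = (n - (j+1)) + 1 := by omega
    rw [this, pow_succ]; ring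
  · have := Nat.choose_succ_right_eq n j
    calc _ = (n.choose (j+1) * (j+1)) * m ^ (j+1) * (n - m) ^ (n - (j+1)) := by ring
      _ = _ := by rw [this]; ring

lemma TT_up (n m j : ℕ) (hm : m ≤ n) (hj : j < m) : TT n m j ≤ TT n m (j+1) := by
  obtain ⟨h1, h2⟩ := TT_eq n m j (by omega)
  apply Nat.le_of_mul_le_mul_left (c := j+1) _ (by omega)
  rw [h1, h2]
  apply Nat.mul_le_mul_left
  obtain ⟨a, rfl⟩ := Nat.exists_eq_add_of_le hm
  obtain ⟨b, rfl⟩ := Nat.exists_eq_add_of_lt hj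
  have e1 : j + b + 1 + a - (j+b+1) = a := by omega
  have e2 : j + b + 1 + a - j = b + 1 + a := by omega
  rw [e1, e2]
  nlinarith [Nat.zero_le (b*a), Nat.zero_le (b*b), Nat.zero_le (b*j), Nat.zero_le (a*j)]

lemma TT_down (n m j : ℕ) (hm : m ≤ j) (hj : j < n) : TT n m (j+1) ≤ TT n m j := by
  obtain ⟨h1, h2⟩ := TT_eq n m j hj
  apply Nat.le_of_mul_le_mul_left (c := j+1) _ (by omega)
  rw [h1, h2]
  apply Nat.mul_le_mul_left
  obtain ⟨b, rfl⟩ := Nat.exists_eq_add_of_le hm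
  obtain ⟨a, rfl⟩ := Nat.exists_eq_add_of_lt hj
  have e1 : m + b + a + 1 - m = b + a + 1 := by omega
  have e2 : m + b + a + 1 - (m + b) = a + 1 := by omega
  rw [e1, e2]
  nlinarith [Nat.zero_le (b*a), Nat.zero_le (b*b), Nat.zero_le (b*m), Nat.zero_le (a*m)]

lemma TT_le (n m j : ℕ) (hm : m ≤ n) (hj : j ≤ n) : TT n m j ≤ TT n m m := by
  rcases le_total j m with h | h
  · induction h using Nat.decreasingInduction with
    | self => exact le_rfl
    | of_succ k hk ih => exact (TT_up n m k hm hk).trans (ih (by omega))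
  · induction j, h using Nat.le_induction with
    | base => exact le_rfl
    | succ k hk ih => exact (TT_down n m k hk (by omega)).trans (ih (by omega))

lemma mode (n m : ℕ) (hm : m ≤ n) : n ^ n ≤ (n + 1) * TT n m m := by
  have h := add_pow m (n - m) n
  rw [Nat.add_sub_cancel' hm] at h
  rw [h]
  calc _ ≤ ∑ j ∈ range (n+1), TT n m m := by
        apply Finset.sum_le_sum
        intro j hj
        have := TT_le n m j hm (by simp at hj; omega)
        refine le_trans (le_of_eq ?_) this
        unfold TT; push_cast; ring_nf
    _ = _ := by simp

lemma mode2 (n m : ℕ) (hn : 0 < n) (hm : m ≤ n) :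
    1 ≤ ((n:ℝ) + 1) * (n.choose m * ((m:ℝ)/n) ^ m * (1 - (m:ℝ)/n) ^ (n - m)) := by
  have h := mode n m hm
  have hn' : (0:ℝ) < n := by exact_mod_cast hn
  have h' : ((n:ℝ)) ^ n ≤ (n + 1) * (n.choose m * (m:ℝ) ^ m * ((n:ℝ) - m) ^ (n - m)) := by
    have : ((n ^ n : ℕ):ℝ) ≤ (((n + 1) * TT n m m : ℕ) : ℝ) := by exact_mod_cast h
    unfold TT at this
    push_cast [Nat.cast_sub hm] at this
    exact this
  have e : (1 - (m:ℝ)/n) = ((n:ℝ) - m) / n := by field_simp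
  rw [e, div_pow, div_pow]
  have : (n:ℝ)^m * (n:ℝ)^(n-m) = (n:ℝ)^n := by rw [← pow_add, Nat.add_sub_cancel' hm]
  have e2 : ((n:ℝ) + 1) * (n.choose m * ((m:ℝ) ^ m / n ^ m) * (((n:ℝ) - m) ^ (n - m) / n ^ (n - m)))
    = (n + 1) * (n.choose m * (m:ℝ) ^ m * ((n:ℝ) - m) ^ (n - m)) / n ^ n := by
    rw [← this]; field_simp
  rw [e2, le_div_iff₀ (by positivity)]
  simpa using h'

lemma card_sphere (n m : ℕ) : (sphereB n m).card = n.choose m := by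
  have : n.choose m = ((Finset.univ : Finset (Fin n)).powersetCard m).card := by simp
  rw [this]
  refine Finset.card_bij' (fun u _ => univ.filter (fun i => u i ≠ 0))
    (fun S _ => fun i => if i ∈ S then (1 : ZMod 2) else 0) ?_ ?_ ?_ ?_
  · intro u hu
    simp only [sphereB, Finset.mem_filter, Finset.mem_univ, true_and] at hu
    simp only [Finset.mem_powersetCard, Finset.subset_univ, true_and]
    exact hu
  · intro S hS
    simp only [Finset.mem_powersetCard, Finset.subset_univ, true_and] at hS
    simp [sphereB, hammingNorm, hS]
  · intro u hu
    have h : ∀ a : ZMod 2, a = 0 ∨ a = 1 := by decide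
    ext i
    rcases h (u i) with h | h <;> simp [h]
  · intro S hS
    ext i
    simp

lemma slice {n m : ℕ} (hn : 0 < n) (hm : m ≤ n) (V : Fin n → ℝ) (hV : ∑ i, V i = 0) (l t : ℝ)
    (hl : 0 ≤ l) :
    (((sphereB n m).filter (fun u => t ≤ ip u V)).card : ℝ) ≤
      (n + 1) * (sphereB n m).card * exp (l ^ 2 * (∑ i, V i ^ 2) / 2 - l * t) := by
  classical
  set p : ℝ := (m:ℝ)/n with hp
  have hn' : (0:ℝ) < n := by exact_mod_cast hn
  have hp0 : 0 ≤ p := by positivity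
  have hp1 : p ≤ 1 := by rw [hp, div_le_one hn']; exact_mod_cast hm
  have hmode := mode2 n m hn hm
  rw [← hp, ← card_sphere] at hmode
  let f : Fin n → ZMod 2 → ℝ := fun i a => if a = 0 then 1 - p else p * exp (l * V i)
  have hf0 : ∀ i a, 0 ≤ f i a := by
    intro i a
    simp only [f]
    split_ifs
    · linarith
    · positivity
  have htot : ∑ u : Fin n → ZMod 2, ∏ i, f i (u i) ≤ exp (l ^ 2 * (∑ i, V i ^ 2) / 2) := by
    have e : ∑ u : Fin n → ZMod 2, ∏ i, f i (u i) = ∏ i, ∑ a, f i a := by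
      rw [Finset.prod_univ_sum]; simp
    rw [e]
    calc ∏ i, ∑ a, f i a ≤ ∏ i, exp (p * (l * V i) + (l * V i) ^ 2 / 2) := by
          apply Finset.prod_le_prod
          · intro i _
            exact Finset.sum_nonneg (fun a _ => hf0 i a)
          · intro i _
            have : ∑ a, f i a = f i 0 + f i 1 := Fin.sum_univ_two _
            rw [this]
            simp only [f, if_true, one_ne_zero, if_false]
            exact hoeff p _ hp0 hp1
      _ = exp (∑ i, (p * (l * V i) + (l * V i) ^ 2 / 2)) := (Real.exp_sum _ _).symm
      _ = _ := by
          congr 1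
          have : ∀ i, p * (l * V i) + (l * V i) ^ 2 / 2 = p * l * V i + l^2/2 * V i ^ 2 := by
            intro i; ring
          simp_rw [this]
          rw [Finset.sum_add_distrib, ← Finset.mul_sum, ← Finset.mul_sum, hV]
          ring
  have hterm : ∀ u ∈ sphereB n m, ∏ i, f i (u i) = p ^ m * (1 - p) ^ (n - m) * exp (l * ip u V) := by
    intro u hu
    simp only [sphereB, Finset.mem_filter, Finset.mem_univ, true_and] at hu
    have e1 : ∀ i, f i (u i) = (if u i ≠ 0 then p else (1 - p)) * exp (l * (xx (u i) * V i)) := by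
      intro i
      by_cases h : u i = 0 <;> simp [f, xx, h]
    simp_rw [e1]
    rw [Finset.prod_mul_distrib, ← Real.exp_sum, ← Finset.mul_sum, Finset.prod_ite]
    simp only [Finset.prod_const]
    have c1 : (univ.filter (fun i => u i ≠ 0)).card = m := hu
    have c2 : (univ.filter (fun i => ¬ u i ≠ 0)).card = n - m := by
      have := Finset.card_filter_add_card_filter_not (s := (univ : Finset (Fin n))) (fun i => u i ≠ 0)
      simp only [Finset.card_univ, Fintype.card_fin] at this
      omega
    rw [c1, c2]
    rfl
  set P := p ^ m * (1 - p) ^ (n - m) with hP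
  have hP0 : 0 ≤ P := by
    have : 0 ≤ 1 - p := by linarith
    positivity
  set K := (((sphereB n m).filter (fun u => t ≤ ip u V)).card : ℝ) with hK
  have h1 : K * (P * exp (l * t)) ≤ exp (l ^ 2 * (∑ i, V i ^ 2) / 2) := by
    refine le_trans ?_ htot
    calc K * (P * exp (l * t)) = ∑ u ∈ (sphereB n m).filter (fun u => t ≤ ip u V), P * exp (l * t) := by
          rw [Finset.sum_const, nsmul_eq_mul]
      _ ≤ ∑ u ∈ (sphereB n m).filter (fun u => t ≤ ip u V), ∏ i, f i (u i) := by
          apply Finset.sum_le_sum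
          intro u hu
          rw [Finset.mem_filter] at hu
          rw [hterm u hu.1]
          have := hu.2
          gcongr
      _ ≤ _ := by
          apply Finset.sum_le_sum_of_subset_of_nonneg (Finset.subset_univ _)
          intro u _ _
          exact Finset.prod_nonneg (fun i _ => hf0 i _)
  have hK0 : 0 ≤ K := Nat.cast_nonneg _
  rw [sub_eq_add_neg, exp_add, exp_neg]
  set E := exp (l ^ 2 * (∑ i, V i ^ 2) / 2)
  have hm2 : 1 ≤ ((n:ℝ)+1) * ((sphereB n m).card * P) := by
    rw [hP]; convert hmode using 1; ring
  rw [← mul_assoc, ← div_eq_mul_inv, le_div_iff₀ (exp_pos _)]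
  calc K * exp (l * t) ≤ K * exp (l*t) * (((n:ℝ)+1) * ((sphereB n m).card * P)) :=
        le_mul_of_one_le_right (by positivity) hm2
    _ = (((n:ℝ)+1) * (sphereB n m).card) * (K * (P * exp (l * t))) := by ring
    _ ≤ _ := mul_le_mul_of_nonneg_left h1 (by positivity)

lemma mem_sphere {n m : ℕ} (u : Fin n → ZMod 2) : u ∈ sphereB n m ↔ hammingNorm u = m := by
  simp [sphereB]

lemma sumA {n : ℕ} (hn : 0 < n) (M : ℝ) (V : Fin n → ℝ) (hV : ∑ i, V i = 0) (l t : ℝ)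
    (hl : 0 ≤ l) :
    (((univ.filter (fun u : Fin n → ZMod 2 => (hammingNorm u : ℝ) ≤ M)).filter
      (fun u => t ≤ ip u V)).card : ℝ) ≤
      (n + 1) * ((univ.filter (fun u : Fin n → ZMod 2 => (hammingNorm u : ℝ) ≤ M)).card : ℝ)
        * exp (l ^ 2 * (∑ i, V i ^ 2) / 2 - l * t) := by
  classical
  set A := univ.filter (fun u : Fin n → ZMod 2 => (hammingNorm u : ℝ) ≤ M) with hA
  have hle : ∀ u : Fin n → ZMod 2, hammingNorm u ∈ range (n+1) := by
    intro u
    have := hammingNorm_le_card_fintype (x := u)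
    simp only [Fintype.card_fin] at this
    simp; omega
  rw [Finset.card_eq_sum_card_fiberwise (f := hammingNorm) (t := range (n+1)) (s := A.filter _)
    (fun u _ => hle u)]
  rw [Finset.card_eq_sum_card_fiberwise (f := hammingNorm) (t := range (n+1)) (s := A)
    (fun u _ => hle u)]
  push_cast
  rw [Finset.mul_sum, Finset.sum_mul]
  apply Finset.sum_le_sum
  intro m hm
  by_cases h : (m : ℝ) ≤ M
  · have e1 : A.filter (fun u => hammingNorm u = m) = sphereB n m := by
      ext u
      simp only [hA, mem_sphere, Finset.mem_filter, Finset.mem_univ, true_and]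
      constructor
      · exact fun h => h.2
      · rintro rfl; exact ⟨h, rfl⟩
    have e2 : (A.filter (fun u => t ≤ ip u V)).filter (fun u => hammingNorm u = m)
        = (sphereB n m).filter (fun u => t ≤ ip u V) := by
      rw [← e1, Finset.filter_comm]
    rw [e1, e2]
    exact slice hn (by simp at hm; omega) V hV l t hl
  · have e2 : (A.filter (fun u => t ≤ ip u V)).filter (fun u => hammingNorm u = m) = ∅ := by
      ext u
      simp only [hA, Finset.mem_filter, Finset.mem_univ, true_and, Finset.notMem_empty, iff_false]
      rintro ⟨⟨h1, _⟩, rfl⟩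
      exact h h1
    rw [e2]
    simp only [Finset.card_empty, Nat.cast_zero]
    positivity

noncomputable def NN (n s : ℕ) (i j : Fin n) : ℝ := ∑ w ∈ sphereB n s, xx (w i) * xx (w j)

lemma NN_comm (n s : ℕ) (i j : Fin n) : NN n s i j = NN n s j i := by
  unfold NN
  simp_rw [mul_comm]

lemma NN_perm (n s : ℕ) (i j : Fin n) (σ : Equiv.Perm (Fin n)) :
    NN n s (σ i) (σ j) = NN n s i j := by
  unfold NN
  have hs : ∀ (τ : Equiv.Perm (Fin n)) (w : Fin n → ZMod 2), w ∈ sphereB n s →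
      (fun i => w (τ i)) ∈ sphereB n s := by
    intro τ w hw
    rw [mem_sphere] at hw ⊢
    have : ((hammingNorm (fun i => w (τ i)) : ℕ) : ℝ) = hammingNorm w := by
      rw [norm_xx, norm_xx]
      exact Equiv.sum_comp τ (fun i => xx (w i))
    rw [← hw]; exact_mod_cast this
  refine Finset.sum_bij' (fun w _ => fun i => w (σ i)) (fun w _ => fun i => w (σ.symm i))
    (fun w hw => hs σ w hw) (fun w hw => hs σ.symm w hw) ?_ ?_ ?_
  · intro w _; funext i; simp
  · intro w _; funext i; simp
  · intro w _; rfl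

lemma NN_diag (n s : ℕ) (i j : Fin n) : NN n s i i = NN n s j j := by
  have := NN_perm n s j j (Equiv.swap j i)
  simpa using this

lemma NN_off1 (n s : ℕ) (i j j' : Fin n) (h : j ≠ i) (h' : j' ≠ i) :
    NN n s i j = NN n s i j' := by
  have := NN_perm n s i j (Equiv.swap j j')
  rw [Equiv.swap_apply_of_ne_of_ne h.symm h'.symm, Equiv.swap_apply_left] at this
  exact this.symm

lemma NN_off (n s : ℕ) (i j i' j' : Fin n) (h : i ≠ j) (h' : i' ≠ j') :
    NN n s i j = NN n s i' j' := by
  by_cases hc : j' = i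
  · subst hc
    rw [NN_comm n s i' j']
    exact NN_off1 n s _ _ _ h.symm h'
  · rw [NN_off1 n s i j j' h.symm hc, NN_comm, NN_comm n s i']
    exact NN_off1 n s _ _ _ (Ne.symm hc) h'

lemma cheb (n s : ℕ) (hns : n = s ^ 2) (hs : 0 < s) (V : Fin n → ℝ) (hV : ∑ i, V i = 0) :
    (s:ℝ) ^ 3 * (((sphereB n s).filter (fun w => (s:ℝ) < ip w V)).card : ℝ) ≤
      (sphereB n s).card * ∑ i, V i ^ 2 := by
  classical
  have hs' : (0:ℝ) < s := by exact_mod_cast hs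
  have hn : 0 < n := by rw [hns]; positivity
  let i0 : Fin n := ⟨0, hn⟩
  obtain ⟨b, hb0, hb⟩ : ∃ b : ℝ, 0 ≤ b ∧ ∀ i j, i ≠ j → NN n s i j = b := by
    by_cases h : ∃ i j : Fin n, i ≠ j
    · obtain ⟨i, j, hij⟩ := h
      refine ⟨NN n s i j, ?_, fun i' j' h' => NN_off n s _ _ _ _ h' hij⟩
      exact Finset.sum_nonneg (fun w _ => mul_nonneg (xx_nonneg _) (xx_nonneg _))
    · exact ⟨0, le_rfl, fun i j hij => absurd ⟨i, j, hij⟩ h⟩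
  set a := NN n s i0 i0 with ha
  have hsa : s * a = (sphereB n s).card := by
    have h1 : ∑ i, NN n s i i = s * (sphereB n s).card := by
      unfold NN
      rw [Finset.sum_comm]
      simp_rw [xx_sq, ← norm_xx]
      rw [Finset.sum_congr rfl (g := fun _ => (s:ℝ))]
      · simp [mul_comm]
      · intro w hw
        rw [mem_sphere] at hw; rw [hw]
    have h2 : ∑ i, NN n s i i = n * a := by
      rw [Finset.sum_congr rfl (g := fun _ => a) (fun i _ => NN_diag n s i i0)]
      simp
    have hnc : (n:ℝ) = (s:ℝ)^2 := by exact_mod_cast hns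
    rw [h2, hnc] at h1
    have : (s:ℝ) * (s * a) = s * (sphereB n s).card := by rw [← h1]; ring
    exact mul_left_cancel₀ hs'.ne' this
  have hN : ∀ i j, NN n s i j = b + if i = j then a - b else 0 := by
    intro i j
    by_cases h : i = j
    · subst h; simp [ha, NN_diag n s i i0]
    · simp [h, hb i j h]
  have hsum : ∑ w ∈ sphereB n s, (ip w V) ^ 2 = (a - b) * ∑ i, V i ^ 2 := by
    have e : ∀ w : Fin n → ZMod 2, (ip w V)^2 = ∑ i, ∑ j, (xx (w i) * xx (w j)) * (V i * V j) := by
      intro w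
      rw [sq, ip, Finset.sum_mul_sum]
      refine Finset.sum_congr rfl (fun i _ => Finset.sum_congr rfl (fun j _ => by ring))
    simp_rw [e]
    rw [Finset.sum_comm]
    have e2 : ∀ i, ∑ w ∈ sphereB n s, ∑ j, (xx (w i) * xx (w j)) * (V i * V j)
        = (a - b) * V i ^ 2 := by
      intro i
      rw [Finset.sum_comm]
      simp_rw [← Finset.sum_mul]
      have : ∀ j, (∑ w ∈ sphereB n s, xx (w i) * xx (w j)) * (V i * V j)
          = (b * V i) * V j + if i = j then (a - b) * V i * V j else 0 := by
        intro j
        have := hN i j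
        unfold NN at this
        rw [this]
        split_ifs <;> ring
      simp_rw [this]
      rw [Finset.sum_add_distrib, ← Finset.mul_sum, hV]
      simp; ring
    simp_rw [e2]
    rw [Finset.mul_sum]
  have hcount : (s:ℝ)^2 * (((sphereB n s).filter (fun w => (s:ℝ) < ip w V)).card : ℝ)
      ≤ ∑ w ∈ sphereB n s, (ip w V) ^ 2 := by
    calc _ = ∑ w ∈ (sphereB n s).filter (fun w => (s:ℝ) < ip w V), (s:ℝ)^2 := by
          simp [mul_comm]
      _ ≤ ∑ w ∈ (sphereB n s).filter (fun w => (s:ℝ) < ip w V), (ip w V)^2 := by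
          apply Finset.sum_le_sum
          intro w hw
          have := (Finset.mem_filter.1 hw).2
          gcongr
      _ ≤ _ := by
          apply Finset.sum_le_sum_of_subset_of_nonneg (Finset.filter_subset _ _)
          intros; positivity
  rw [hsum] at hcount
  have hV2 : 0 ≤ ∑ i, V i ^ 2 := Finset.sum_nonneg (fun i _ => sq_nonneg _)
  rw [← hsa]
  have h3 : (a - b) * ∑ i, V i ^ 2 ≤ a * ∑ i, V i ^ 2 :=
    mul_le_mul_of_nonneg_right (by linarith) hV2
  have := mul_le_mul_of_nonneg_left (hcount.trans h3) hs'.le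
  calc _ = _ := by ring
    _ ≤ _ := this
    _ = _ := by ring

noncomputable def vv {n : ℕ} (s : ℕ) (w : Fin n → ZMod 2) : Fin n → ℝ := fun i => xx (w i) - 1 / s

lemma greedy (n s k : ℕ) (hns : n = s ^ 2) (hs : 0 < s) (B' U : Finset (Fin n → ZMod 2)) (D : ℝ)
    (hB : B' ⊆ sphereB n s) (hBn : 0 < B'.card)
    (hbad : ∀ V : Fin n → ℝ, ∑ i, V i = 0 → ∑ i, V i ^ 2 ≤ 3 * k * s →
      12 * (((sphereB n s).filter (fun w => (s:ℝ) < ip w V)).card : ℝ) ≤ B'.card)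
    (hU : ∀ u ∈ U, (B'.card : ℝ) / 3 ≤ ((B'.filter (fun w => D ≤ ip u (vv s w))).card : ℝ))
    (j : ℕ) (hj : j ≤ k) :
    ∃ V : Fin n → ℝ, ∑ i, V i = 0 ∧ ∑ i, V i ^ 2 ≤ 3 * j * s ∧
      (U.card : ℝ) ≤ 4 ^ j * ((U.filter (fun u => j * D ≤ ip u V)).card : ℝ) := by
  classical
  have hs' : (0:ℝ) < s := by exact_mod_cast hs
  induction j with
  | zero =>
    refine ⟨fun _ => 0, by simp, by simp, ?_⟩
    simp [ip]
  | succ j ih =>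
    obtain ⟨V, hV0, hV2, hVU⟩ := ih (by omega)
    have hjk : (j:ℝ) ≤ k := by exact_mod_cast (by omega : j ≤ k)
    have hb := hbad V hV0 (hV2.trans (by gcongr))
    set Uj := U.filter (fun u => j * D ≤ ip u V) with hUj
    set B2 := B'.filter (fun w => ¬ (s:ℝ) < ip w V) with hB2
    have hbb : 12 * ((B'.filter (fun w => (s:ℝ) < ip w V)).card : ℝ) ≤ B'.card := by
      refine le_trans ?_ hb
      have := Finset.card_le_card (Finset.filter_subset_filter (fun w => (s:ℝ) < ip w V) hB)
      have : ((B'.filter (fun w => (s:ℝ) < ip w V)).card : ℝ) ≤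
        (((sphereB n s).filter (fun w => (s:ℝ) < ip w V)).card : ℝ) := by exact_mod_cast this
      linarith
    have hsplit : ((B'.filter (fun w => (s:ℝ) < ip w V)).card : ℝ) + B2.card = B'.card := by
      exact_mod_cast Finset.card_filter_add_card_filter_not (s := B') (fun w => (s:ℝ) < ip w V)
    have hBn' : (0:ℝ) < B'.card := by exact_mod_cast hBn
    have hB2n : B2.Nonempty := by
      rw [← Finset.card_pos]
      have : (0:ℝ) < B2.card := by linarith
      exact_mod_cast this
    have hu : ∀ u ∈ Uj, (B'.card : ℝ) ≤ 4 * ((B2.filter (fun w => D ≤ ip u (vv s w))).card : ℝ) := by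
      intro u hu
      have h1 := hU u (Finset.mem_filter.1 hu).1
      have h2 : B'.filter (fun w => D ≤ ip u (vv s w)) ⊆
          B'.filter (fun w => (s:ℝ) < ip w V) ∪ B2.filter (fun w => D ≤ ip u (vv s w)) := by
        intro w hw
        simp only [hB2, Finset.mem_union, Finset.mem_filter] at hw ⊢
        tauto
      have h3 := (Finset.card_le_card h2).trans (Finset.card_union_le _ _)
      have h3' : ((B'.filter (fun w => D ≤ ip u (vv s w))).card : ℝ) ≤
          ((B'.filter (fun w => (s:ℝ) < ip w V)).card : ℝ) +
          ((B2.filter (fun w => D ≤ ip u (vv s w))).card : ℝ) := by exact_mod_cast h3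
      linarith
    have hdc : ∑ u ∈ Uj, ((B2.filter (fun w => D ≤ ip u (vv s w))).card : ℝ) =
        ∑ w ∈ B2, ((Uj.filter (fun u => D ≤ ip u (vv s w))).card : ℝ) := by
      simp_rw [Finset.card_filter]
      push_cast
      rw [Finset.sum_comm]
    obtain ⟨w, hw, hwU⟩ : ∃ w ∈ B2, (Uj.card : ℝ) ≤
        4 * ((Uj.filter (fun u => D ≤ ip u (vv s w))).card : ℝ) := by
      apply Finset.exists_le_of_sum_le hB2n
      rw [← Finset.mul_sum, ← hdc, Finset.mul_sum]
      calc ∑ w ∈ B2, (Uj.card : ℝ) = B2.card * Uj.card := by simp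
        _ ≤ B'.card * Uj.card := by
            gcongr
            exact Finset.filter_subset _ _
        _ = ∑ u ∈ Uj, (B'.card : ℝ) := by simp [mul_comm]
        _ ≤ _ := Finset.sum_le_sum hu
    have hwB : hammingNorm w = s := (mem_sphere w).1 (hB (Finset.mem_filter.1 hw).1)
    have hwV : ip w V ≤ s := not_lt.1 (Finset.mem_filter.1 hw).2
    have hxs : ∑ i, xx (w i) = s := by rw [← norm_xx, hwB]
    refine ⟨fun i => V i + vv s w i, ?_, ?_, ?_⟩
    · rw [Finset.sum_add_distrib, hV0]
      unfold vv
      rw [Finset.sum_sub_distrib, hxs]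
      simp [hns]
      field_simp
      ring
    · have e : ∀ i, (V i + vv s w i)^2 = V i ^2 + 2 * (xx (w i) * V i) - 2 / s * V i
          + (1 - 2 / s) * xx (w i) + 1 / s^2 := by
        intro i
        unfold vv
        have := xx_sq (w i)
        linear_combination this
      simp_rw [e]
      rw [Finset.sum_add_distrib, Finset.sum_add_distrib, Finset.sum_sub_distrib,
        Finset.sum_add_distrib, ← Finset.mul_sum, ← Finset.mul_sum, ← Finset.mul_sum, hV0, hxs]
      have h1 : ∑ i : Fin n, (1:ℝ) / s^2 = 1 := by
        simp [hns]; field_simp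
      have h2 : (1 - 2 / (s:ℝ)) * s = s - 2 := by field_simp
      rw [h1, h2]
      change _ + 2 * ip w V - _ + _ + _ ≤ _
      push_cast
      linarith
    · have hsub : Uj.filter (fun u => D ≤ ip u (vv s w)) ⊆
          U.filter (fun u => ((j+1 : ℕ):ℝ) * D ≤ ip u (fun i => V i + vv s w i)) := by
        intro u hu
        simp only [hUj, Finset.mem_filter] at hu ⊢
        refine ⟨hu.1.1, ?_⟩
        have : ip u (fun i => V i + vv s w i) = ip u V + ip u (vv s w) := by
          unfold ip
          rw [← Finset.sum_add_distrib]
          exact Finset.sum_congr rfl (fun i _ => by ring)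
        rw [this]
        push_cast
        linarith [hu.1.2, hu.2]
      have hc : ((Uj.filter (fun u => D ≤ ip u (vv s w))).card : ℝ) ≤
          ((U.filter (fun u => ((j+1 : ℕ):ℝ) * D ≤ ip u (fun i => V i + vv s w i))).card : ℝ) := by
        exact_mod_cast Finset.card_le_card hsub
      rw [pow_succ]
      have h4 : (0:ℝ) ≤ 4 ^ j := by positivity
      calc (U.card : ℝ) ≤ 4 ^ j * Uj.card := hVU
        _ ≤ 4 ^ j * (4 * ((U.filter (fun u => ((j+1 : ℕ):ℝ) * D ≤
              ip u (fun i => V i + vv s w i))).card : ℝ)) := by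
            apply mul_le_mul_of_nonneg_left _ h4
            linarith
        _ = _ := by ring

end

theorem stmt17 (δ : ℝ) (hδ : 0 < δ) :
    ∃ N : ℕ, ∀ n s : ℕ, n = s ^ 2 → N ≤ n →
      ∀ B' : Finset (Fin n → ZMod 2), B' ⊆ sphereB n s →
        δ * (sphereB n s).card ≤ (B'.card : ℝ) →
        (Set.ncard {u : Fin n → ZMod 2 | u ∈ setA' n ∧ Compatible n B' u} : ℝ) ≤
          Real.exp (-(n : ℝ) ^ ((3 : ℝ) / 4)) * (setA' n).ncard := by
  classical
  refine ⟨(⌈(72/δ)^2⌉₊ + 2)^2, ?_⟩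
  intro n s hns hN B' hB hcard
  have hs0 : ⌈(72/δ)^2⌉₊ + 2 ≤ s := by
    rw [hns] at hN
    exact (Nat.pow_le_pow_iff_left (by norm_num)).1 hN
  have hs : 0 < s := by omega
  have hs' : (0:ℝ) < s := by exact_mod_cast hs
  have hs2 : (2:ℝ) ≤ s := by exact_mod_cast (by omega : 2 ≤ s)
  have hn : 0 < n := by rw [hns]; positivity
  obtain ⟨r, hr0, hrs⟩ : ∃ r : ℝ, 0 < r ∧ (s:ℝ) = r ^ 2 :=
    ⟨Real.sqrt s, Real.sqrt_pos.2 hs', (Real.sq_sqrt hs'.le).symm⟩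
  have hnr : (n:ℝ) = r ^ 4 := by rw [hns]; push_cast; rw [hrs]; ring
  have hn34 : (n:ℝ) ^ ((3:ℝ)/4) = r ^ 3 := by
    rw [hnr, ← Real.rpow_natCast r 4, ← Real.rpow_mul hr0.le, ← Real.rpow_natCast r 3]
    norm_num
  have hrδ : 72 ≤ δ * r := by
    have h1 : (72/δ)^2 ≤ (s:ℝ) := by
      refine (Nat.le_ceil _).trans ?_
      exact_mod_cast (by omega : ⌈(72/δ)^2⌉₊ ≤ s)
    rw [hrs] at h1
    have := (pow_le_pow_iff_left₀ (by positivity) hr0.le (by norm_num)).1 h1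
    rw [div_le_iff₀ hδ] at this
    linarith
  have hr1 : 1 ≤ r := by nlinarith
  set M : ℝ := (n:ℝ) / 2 - 10 ^ 15 * (n : ℝ) ^ ((3 : ℝ) / 4) with hM
  set A : Finset (Fin n → ZMod 2) := univ.filter (fun u => (hammingNorm u : ℝ) ≤ M) with hA
  set U : Finset (Fin n → ZMod 2) := A.filter (fun u => Compatible n B' u) with hU
  have eA : (setA' n).ncard = A.card := by
    rw [← Set.ncard_coe_finset]
    congr 1
    ext u
    simp [setA', hA, hM]
  have eU : Set.ncard {u : Fin n → ZMod 2 | u ∈ setA' n ∧ Compatible n B' u} = U.card := by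
    rw [← Set.ncard_coe_finset]
    congr 1
    ext u
    simp [setA', hA, hM, hU]
  rw [eA, eU, hn34]
  set k := ⌈r^3⌉₊ with hk
  have hk1 : r^3 ≤ k := Nat.le_ceil _
  have hr3 : 1 ≤ r^3 := one_le_pow₀ hr1
  have hk2 : (k:ℝ) ≤ 2 * r^3 := by
    have := (Nat.ceil_lt_add_one (by positivity : 0 ≤ r^3)).le
    linarith
  have hSpos : 0 < (sphereB n s).card := by
    rw [card_sphere]
    apply Nat.choose_pos
    rw [hns]; nlinarith
  have hSpos' : (0:ℝ) < (sphereB n s).card := by exact_mod_cast hSpos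
  have hBn : 0 < B'.card := by
    have : (0:ℝ) < B'.card := lt_of_lt_of_le (by positivity) hcard
    exact_mod_cast this
  obtain ⟨V, hV0, hV2, hVU⟩ := greedy n s k hns hs B' U (10^15 * r) hB hBn (by
    intro V hV0 hV2
    have h := cheb n s hns hs V hV0
    set c := (((sphereB n s).filter (fun w => (s:ℝ) < ip w V)).card : ℝ) with hc
    have hc0 : 0 ≤ c := Nat.cast_nonneg _
    have h1 : (s:ℝ)^3 * c ≤ (sphereB n s).card * (3 * k * s) :=
      h.trans (mul_le_mul_of_nonneg_left hV2 hSpos'.le)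
    have h2 : (s:ℝ)^3 * c ≤ (sphereB n s).card * (3 * (2 * r^3) * s) :=
      h1.trans (by gcongr)
    rw [hrs] at h2
    have h3 : r^5 * (r * c) ≤ r^5 * (6 * (sphereB n s).card) := by
      calc _ = _ := by ring
        _ ≤ _ := h2
        _ = _ := by ring
    have h4 := le_of_mul_le_mul_left h3 (by positivity)
    have h5 : 72 * c ≤ δ * r * c := mul_le_mul_of_nonneg_right hrδ hc0
    have h6 : δ * (r * c) ≤ δ * (6 * (sphereB n s).card) := mul_le_mul_of_nonneg_left h4 hδ.le
    linarith) (by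
    intro u hu
    rw [hU, Finset.mem_filter] at hu
    obtain ⟨huA, huC⟩ := hu
    refine le_trans huC ?_
    norm_cast
    apply Finset.card_le_card
    intro w hw
    rw [Finset.mem_filter] at hw ⊢
    refine ⟨hw.1, ?_⟩
    have hwB : hammingNorm w = s := (mem_sphere w).1 (hB hw.1)
    have h1 : ((hammingNorm (u+w) : ℕ) : ℝ) ≤ hammingNorm u := by exact_mod_cast hw.2
    rw [norm_add_xx, hwB] at h1
    have h2 : (hammingNorm u : ℝ) ≤ M := (Finset.mem_filter.1 huA).2
    have e : ip u (vv s w) = ∑ i, xx (u i) * xx (w i) - hammingNorm u / s := by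
      rw [norm_xx, Finset.sum_div, ← Finset.sum_sub_distrib]
      unfold ip vv
      exact Finset.sum_congr rfl (fun i _ => by ring)
    rw [e]
    have h3 : (hammingNorm u : ℝ) / s ≤ M / s := by gcongr
    have h4 : M / s = s / 2 - 10^15 * r := by
      rw [hM, hn34, hnr, hrs]; field_simp
    push_cast
    linarith) k le_rfl
  have hUA : (U.filter (fun u => k * (10^15 * r) ≤ ip u V)).card ≤
      (A.filter (fun u => k * (10^15 * r) ≤ ip u V)).card :=
    Finset.card_le_card (Finset.filter_subset_filter _ (Finset.filter_subset _ _))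
  have hsum := sumA hn M V hV0 (1/r) (k * (10^15 * r)) (by positivity)
  rw [← hA] at hsum
  have hexp : (1/r) ^ 2 * (∑ i, V i ^ 2) / 2 - (1/r) * (k * (10^15 * r)) ≤
      3 / 2 * k - 10^15 * k := by
    have h1 : (1/r) ^ 2 * (∑ i, V i ^ 2) ≤ (1/r)^2 * (3 * k * s) := by gcongr
    have h2 : (1/r)^2 * (3 * k * s) = 3 * k := by rw [hrs]; field_simp
    have h3 : (1/r) * (k * (10^15 * r)) = 10^15 * k := by field_simp
    linarith
  have h4 : (4:ℝ)^k ≤ Real.exp (2 * k) := by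
    have h : (4:ℝ) ≤ Real.exp 2 := by
      have h1 := Real.add_one_le_exp 1
      have h2 : Real.exp 2 = Real.exp 1 * Real.exp 1 := by rw [← Real.exp_add]; norm_num
      rw [h2]; nlinarith
    rw [mul_comm, Real.exp_nat_mul]
    gcongr
  have hn1 : (n:ℝ) + 1 ≤ Real.exp (r^3) := by
    have := Real.quadratic_le_exp_of_nonneg (by positivity : 0 ≤ r^3)
    refine le_trans ?_ this
    rw [hnr]
    have : 2 ≤ r^2 := by linarith
    have h6 : (r^3)^2 = r^4 * r^2 := by ring
    have : r^4 * 2 ≤ r^4 * r^2 := by gcongr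
    rw [h6]; linarith
  calc (U.card : ℝ) ≤ 4 ^ k * ((U.filter (fun u => k * (10^15 * r) ≤ ip u V)).card : ℝ) := hVU
    _ ≤ 4 ^ k * ((A.filter (fun u => k * (10^15 * r) ≤ ip u V)).card : ℝ) := by
        gcongr
    _ ≤ 4 ^ k * ((n + 1) * A.card * Real.exp (3 / 2 * k - 10^15 * k)) := by
        apply mul_le_mul_of_nonneg_left _ (by positivity)
        refine hsum.trans ?_
        gcongr
    _ ≤ Real.exp (2 * k) * (Real.exp (r^3) * A.card * Real.exp (3 / 2 * k - 10^15 * k)) := by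
        gcongr
    _ = Real.exp (2 * k + r^3 + (3 / 2 * k - 10^15 * k)) * A.card := by
        rw [Real.exp_add, Real.exp_add]; ring
    _ ≤ Real.exp (-r^3) * A.card := by
        gcongr
        nlinarith
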